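/- Let f ∈ C[x_0,x_1,x_2,x_3] be a squarefree polynomial of degree 2d with d ≥ 2 such that V(f) is a nodal surface, and let X : y^2 = f have defect and exactly d(2d-1) nodes. Then there exist homogeneous forms ℓ, g, h of degrees 1, 2d-1, d respectively with f = ℓ g + h^2. -/

import Mathlib

open MvPolynomial

attribute [local instance] MvPolynomial.gradedAlgebra

/-- Hilbert function. -/
noncomputable def hilb (m : ℕ) (I : Ideal (MvPolynomial (Fin m) ℂ)) (k : ℕ) : ℕ :=
  Module.finrank ℂ
    (↥(homogeneousSubmodule (Fin m) ℂ k) ⧸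
      Submodule.comap (homogeneousSubmodule (Fin m) ℂ k).subtype (Submodule.restrictScalars ℂ I))

/-- The Hessian matrix of second partial derivatives of `f`, evaluated at `x`. -/
noncomputable def hessian (m : ℕ) (f : MvPolynomial (Fin m) ℂ) (x : Fin m → ℂ) :
    Matrix (Fin m) (Fin m) ℂ :=
  Matrix.of fun i j => MvPolynomial.eval x (pderiv i (pderiv j f))

/-- The singular locus of `V(f)` in `ℙ^{m-1}`. -/
def singLocus (m : ℕ) (f : MvPolynomial (Fin m) ℂ) : Set (Projectivization ℂ (Fin m → ℂ)) :=
  {p | ∀ i, MvPolynomial.eval p.rep (pderiv i f) = 0}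

/-- `V(f)` is nodal: at every singular point the (homogeneous) Hessian has corank one,
i.e. the singularity is an ordinary double point. -/
def IsNodal (m : ℕ) (f : MvPolynomial (Fin m) ℂ) : Prop :=
  ∀ x : Fin m → ℂ, x ≠ 0 → (∀ i, MvPolynomial.eval x (pderiv i f) = 0) →
    (hessian m f x).rank = m - 1

/-- The homogeneous vanishing ideal of a set of points of `ℙ^{m-1}`
(polynomials vanishing on the affine cone). -/
noncomputable def coneVanishingIdeal (m : ℕ) (Sig : Set (Projectivization ℂ (Fin m → ℂ))) :
    Ideal (MvPolynomial (Fin m) ℂ) :=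
  Ideal.span {g | ∀ p ∈ Sig, ∀ t : ℂ, MvPolynomial.eval (t • p.rep) g = 0}

open Module

theorem Matrix.exists_mulVec_eq_zero_or_exists_mul_eq_smul_one {R κ ι : Type*} [CommRing R]
    [IsDomain R] [Fintype κ] [Fintype ι] [DecidableEq ι] (A : Matrix κ ι R) :
    (∃ p : ι → R, p ≠ 0 ∧ A.mulVec p = 0) ∨
      ∃ (D : Matrix ι κ R) (r : R), r ≠ 0 ∧ D * A = r • (1 : Matrix ι ι R) := by
  classical
  let K := FractionRing R
  let A' : Matrix κ ι K := A.map (algebraMap R K)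
  by_cases hA : LinearMap.ker A'.mulVecLin = ⊥
  · right
    obtain ⟨g, hg⟩ := LinearMap.exists_leftInverse_of_injective _ hA
    have hD : LinearMap.toMatrix' g * A' = 1 := by
      rw [← LinearMap.toMatrix'_toLin' A', ← LinearMap.toMatrix'_comp, Matrix.toLin'_apply', hg,
        LinearMap.toMatrix'_id]
    obtain ⟨r, hr⟩ := IsLocalization.exist_integer_multiples_of_finite (nonZeroDivisors R)
      (fun ij : ι × κ => LinearMap.toMatrix' g ij.1 ij.2)
    choose D hD' using hr
    refine ⟨Matrix.of fun i j => D (i, j), r, nonZeroDivisors.coe_ne_zero r, ?_⟩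
    have hinj := IsFractionRing.injective R K
    have h1 : (Matrix.of fun i j => D (i, j)).map (algebraMap R K) =
        (algebraMap R K r) • LinearMap.toMatrix' g := by
      ext i j
      simp [hD', Algebra.smul_def]
    apply Matrix.map_injective hinj
    change ((Matrix.of fun i j => D (i, j)) * A).map (algebraMap R K) = _
    rw [Matrix.map_mul, h1, Matrix.smul_mul, hD]
    ext i j
    by_cases hij : i = j <;> simp [hij]
  · left
    obtain ⟨v, hv, hv0⟩ := Submodule.exists_mem_ne_zero_of_ne_bot hA
    obtain ⟨r, hr⟩ := IsLocalization.exist_integer_multiples_of_finite (nonZeroDivisors R) v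
    choose p hp using hr
    have hinj := IsFractionRing.injective R K
    have hr0 : algebraMap R K r ≠ 0 := by
      simp
    have hpv : (fun i => algebraMap R K (p i)) = (algebraMap R K r) • v := by
      ext i
      simp [hp, Algebra.smul_def]
    refine ⟨p, ?_, ?_⟩
    · rintro rfl
      have : (algebraMap R K r) • v = 0 := by rw [← hpv]; ext; simp
      exact hv0 ((smul_eq_zero.1 this).resolve_left hr0)
    · ext i
      apply hinj
      have h2 : A'.mulVec ((algebraMap R K r) • v) = 0 := by
        rw [Matrix.mulVec_smul]
        rw [LinearMap.mem_ker, Matrix.mulVecLin_apply] at hv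
        rw [hv, smul_zero]
      rw [← hpv] at h2
      simpa [A', Matrix.mulVec, dotProduct] using congrFun h2 i

/-- If every member of a linear family of linear maps has a kernel, then the kernel vectors can be
chosen to depend polynomially on the parameters. -/
theorem exists_polynomial_family_mem_ker {σ ι W U : Type*} [Fintype σ] [Fintype ι]
    [AddCommGroup W] [Module ℂ W] [AddCommGroup U] [Module ℂ U] [FiniteDimensional ℂ U]
    (T : σ → W →ₗ[ℂ] U) (b : Basis ι ℂ W)
    (h : ∀ a : σ → ℂ, ¬ Function.Injective (∑ l, a l • T l : W →ₗ[ℂ] U)) :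
    ∃ p : ι → MvPolynomial σ ℂ, p ≠ 0 ∧
      ∀ a : σ → ℂ, (∑ l, a l • T l : W →ₗ[ℂ] U) (∑ i, eval a (p i) • b i) = 0 := by
  classical
  let c := finBasis ℂ U
  let A : Matrix (Fin (finrank ℂ U)) ι (MvPolynomial σ ℂ) :=
    Matrix.of fun r i => ∑ l, X l * C (c.repr (T l (b i)) r)
  have hA : ∀ (a : σ → ℂ) (v : ι → ℂ),
      c.repr ((∑ l, a l • T l : W →ₗ[ℂ] U) (∑ i, v i • b i)) = (A.map (eval a)).mulVec v := by
    intro a v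
    ext r
    simp only [A, map_sum, map_smul, LinearMap.sum_apply, LinearMap.smul_apply, Matrix.mulVec,
      dotProduct, Matrix.map_apply, Matrix.of_apply, map_mul, eval_X, eval_C,
      Finsupp.coe_finsetSum, Finsupp.coe_smul, Finset.sum_apply, Pi.smul_apply, smul_eq_mul]
    simp only [Finset.sum_mul, Finset.mul_sum]
    refine Finset.sum_congr rfl fun i _ => Finset.sum_congr rfl fun l _ => by ring
  rcases A.exists_mulVec_eq_zero_or_exists_mul_eq_smul_one with ⟨p, hp0, hp⟩ | ⟨D, r, hr, hD⟩
  · refine ⟨p, hp0, fun a => ?_⟩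
    apply c.repr.injective
    rw [map_zero]
    apply DFunLike.coe_injective
    rw [hA]
    ext i
    have := congrArg (eval a) (congrFun hp i)
    simpa [Matrix.mulVec, dotProduct] using this
  · exfalso
    obtain ⟨a, ha⟩ : ∃ a, eval a r ≠ 0 := by
      by_contra! hcon
      exact hr (MvPolynomial.funext fun x => by simp [hcon])
    apply h a
    rw [injective_iff_map_eq_zero]
    intro w hw
    have h1 := hA a (b.repr w)
    rw [b.sum_repr, hw, map_zero] at h1
    have h2 : (D.map (eval a)) * (A.map (eval a)) = eval a r • (1 : Matrix ι ι ℂ) := by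
      rw [← Matrix.map_mul, hD]
      ext i j
      by_cases hij : i = j <;> simp [hij]
    have h3 : eval a r • (b.repr w : ι → ℂ) = 0 := by
      have : ((D.map (eval a)) * (A.map (eval a))).mulVec (b.repr w) = 0 := by
        rw [← Matrix.mulVec_mulVec, ← h1]
        simp
      rw [h2, Matrix.smul_mulVec, Matrix.one_mulVec] at this
      exact this
    have h4 := (smul_eq_zero.1 h3).resolve_left ha
    apply b.repr.injective
    rw [map_zero]
    exact DFunLike.coe_injective h4

/-- The linear form with coefficient vector `a`. -/
noncomputable def linForm {m : ℕ} (a : Fin m → ℂ) : MvPolynomial (Fin m) ℂ :=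
  ∑ l, C (a l) * X l

theorem linForm_isHomogeneous {m : ℕ} (a : Fin m → ℂ) : (linForm a).IsHomogeneous 1 :=
  IsHomogeneous.sum _ _ _ fun l _ => isHomogeneous_C_mul_X (a l) l

theorem eval_linForm {m : ℕ} (a x : Fin m → ℂ) : eval x (linForm a) = ∑ l, a l * x l := by
  simp [linForm]

theorem linForm_add_smul {m : ℕ} (a b : Fin m → ℂ) (t : ℂ) :
    linForm (a + t • b) = linForm a + t • linForm b := by
  simp [linForm, add_mul, Finset.sum_add_distrib, Finset.smul_sum, smul_eq_C_mul, mul_assoc]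

theorem linForm_single {m : ℕ} (i : Fin m) : linForm (Pi.single i 1) = X i := by
  rw [linForm, Finset.sum_eq_single i] <;> simp +contextual

theorem exists_linForm_eq {m : ℕ} {p : MvPolynomial (Fin m) ℂ} (hp : p.IsHomogeneous 1) :
    ∃ a, p = linForm a := by
  refine ⟨fun i => eval 0 (pderiv i p), ?_⟩
  have h := hp.sum_X_mul_pderiv
  rw [one_smul] at h
  refine h.symm.trans (Finset.sum_congr rfl fun i _ => ?_)
  have h0 : (pderiv i p).IsHomogeneous 0 := hp.pderiv
  have h1 := totalDegree_eq_zero_iff_eq_C.1 ((totalDegree_zero_iff_isHomogeneous _).2 h0)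
  rw [mul_comm]
  congr 1
  rw [h1]
  simp [constantCoeff_eq]

theorem MvPolynomial.IsHomogeneous.exists_sum_X_mul {m k : ℕ} {p : MvPolynomial (Fin m) ℂ}
    (hp : p.IsHomogeneous (k + 1)) :
    ∃ u : Fin m → MvPolynomial (Fin m) ℂ, (∀ i, (u i).IsHomogeneous k) ∧ p = ∑ i, X i * u i := by
  refine ⟨fun i => ((k + 1 : ℕ) : ℂ)⁻¹ • pderiv i p, fun i => ?_, ?_⟩
  · exact (homogeneousSubmodule (Fin m) ℂ k).smul_mem _ hp.pderiv
  · have h := hp.sum_X_mul_pderiv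
    simp only [mul_smul_comm, ← Finset.smul_sum, h]
    rw [← Nat.cast_smul_eq_nsmul ℂ, smul_smul, inv_mul_cancel₀ (by norm_cast), one_smul]

/-- Powers of linear forms span the forms of a given degree. -/
theorem eq_zero_of_linForm_pow {m : ℕ} (n : ℕ) (μ : MvPolynomial (Fin m) ℂ →ₗ[ℂ] ℂ)
    (hμ : ∀ a, μ (linForm a ^ n) = 0) {p : MvPolynomial (Fin m) ℂ} (hp : p.IsHomogeneous n) :
    μ p = 0 := by
  induction n generalizing μ p with
  | zero =>
    have h1 := totalDegree_eq_zero_iff_eq_C.1 ((totalDegree_zero_iff_isHomogeneous _).2 hp)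
    have h2 := hμ 0
    rw [pow_zero] at h2
    rw [h1, ← mul_one (C _), ← smul_eq_C_mul, map_smul, h2, smul_zero]
  | succ n ih =>
    obtain ⟨u, hu, rfl⟩ := hp.exists_sum_X_mul
    rw [map_sum]
    refine Finset.sum_eq_zero fun i _ => ?_
    refine ih (μ ∘ₗ LinearMap.mulLeft ℂ (X i)) (fun a => ?_) (hu i)
    let P : Polynomial ℂ := ∑ j ∈ Finset.range (n + 2),
      Polynomial.C (μ (X i ^ j * linForm a ^ (n + 1 - j)) * ((n + 1).choose j : ℂ)) *
        Polynomial.X ^ j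
    have hP : P = 0 := by
      apply Polynomial.funext
      intro t
      have h := hμ (a + t • Pi.single i 1)
      rw [linForm_add_smul, linForm_single, add_comm, add_pow, map_sum] at h
      rw [Polynomial.eval_zero, ← h, Polynomial.eval_finsetSum]
      refine Finset.sum_congr rfl fun j _ => ?_
      rw [smul_pow, smul_mul_assoc, smul_mul_assoc, map_smul,
        ← map_natCast (C (σ := Fin m) (R := ℂ)),
        mul_comm _ (C _), ← smul_eq_C_mul, map_smul]
      simp
      ring
    have h1 := congrArg (fun q => q.coeff 1) hP
    simp only [P, Polynomial.finsetSum_coeff, Polynomial.coeff_C_mul_X_pow,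
      Polynomial.coeff_zero, Finset.sum_ite_eq] at h1
    rw [if_pos (by simp)] at h1
    have : ((n : ℂ) + 1) ≠ 0 := by norm_cast
    simpa [this] using h1

/-- The space of forms of degree `k` in `m` variables. -/
abbrev Forms (m k : ℕ) : Type := ↥(homogeneousSubmodule (Fin m) ℂ k)

instance (m k : ℕ) : FiniteDimensional ℂ (Forms m k) :=
  Module.Finite.iff_fg.2 (homogeneousSubmodule_fg (Fin m) ℂ k)

/-- Multiplication by the linear form with coefficient vector `a`. -/
noncomputable def mulLin {m : ℕ} (a : Fin m → ℂ) (k : ℕ) : Forms m k →ₗ[ℂ] Forms m (k + 1) :=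
  (LinearMap.mulLeft ℂ (linForm a)).restrict fun p hp => by
    have := (linForm_isHomogeneous a).mul ((mem_homogeneousSubmodule k p).1 hp)
    rwa [add_comm] at this

@[simp]
theorem coe_mulLin {m k : ℕ} (a : Fin m → ℂ) (p : Forms m k) :
    (mulLin a k p : MvPolynomial (Fin m) ℂ) = linForm a * p := rfl

theorem mulLin_eq_sum {m : ℕ} (a : Fin m → ℂ) (k : ℕ) :
    mulLin a k = ∑ l, a l • mulLin (Pi.single l 1) k := by
  ext1 p
  apply Subtype.ext
  simp only [LinearMap.sum_apply, LinearMap.smul_apply, Submodule.coe_sum, Submodule.coe_smul,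
    coe_mulLin, linForm_single]
  simp [linForm, Finset.sum_mul, smul_eq_C_mul, mul_assoc]

theorem mulLin_add_smul {m : ℕ} (a b : Fin m → ℂ) (t : ℂ) {k : ℕ} (p : Forms m k) :
    mulLin (a + t • b) k p = mulLin a k p + t • mulLin b k p := by
  apply Subtype.ext
  simp [linForm_add_smul, add_mul]

/-- The degree `n` component of a polynomial, as a form. -/
noncomputable def projForm (m n : ℕ) : MvPolynomial (Fin m) ℂ →ₗ[ℂ] Forms m n :=
  (homogeneousComponent n).codRestrict _ fun p => homogeneousComponent_mem n p

theorem projForm_of_mem {m n : ℕ} {p : MvPolynomial (Fin m) ℂ} (hp : p.IsHomogeneous n) :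
    projForm m n p = ⟨p, hp⟩ :=
  Subtype.ext (homogeneousComponent_eq_self hp)

theorem mulLin_projForm {m k : ℕ} (a : Fin m → ℂ) {p : MvPolynomial (Fin m) ℂ}
    (hp : p.IsHomogeneous k) :
    mulLin a k (projForm m k p) = projForm m (k + 1) (linForm a * p) := by
  have h := (linForm_isHomogeneous a).mul hp
  rw [add_comm] at h
  rw [projForm_of_mem hp, projForm_of_mem h]
  rfl

/-- A chain of functionals `Λ j` with `Λ (j + 1) (M u) = - Λ j (N u)` and `Λ 0 (M u) = 0` is
linearly independent as soon as `Λ 0` does not vanish on the top power of `N`. -/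
theorem linearIndependent_of_chain {m k : ℕ} (M N : Fin m → ℂ)
    (Λ : ℕ → Dual ℂ (Forms m (k + 1)))
    (h0 : ∀ u, Λ 0 (mulLin M k u) = 0)
    (h1 : ∀ j u, Λ (j + 1) (mulLin M k u) = - Λ j (mulLin N k u))
    (hN : Λ 0 (projForm m (k + 1) (linForm N ^ (k + 1))) ≠ 0) :
    LinearIndependent ℂ (fun j : Fin (k + 2) => Λ j) := by
  let g : ℕ → Forms m k := fun i => projForm m k (linForm M ^ i * linForm N ^ (k - i))
  let e : ℕ → Forms m (k + 1) := fun i =>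
    projForm m (k + 1) (linForm M ^ i * linForm N ^ (k + 1 - i))
  have hhom : ∀ i ≤ k, (linForm M ^ i * linForm N ^ (k - i)).IsHomogeneous k := by
    intro i hi
    have := ((linForm_isHomogeneous M).pow i).mul ((linForm_isHomogeneous N).pow (k - i))
    rwa [one_mul, one_mul, Nat.add_sub_cancel' hi] at this
  have heM : ∀ i ≤ k, e (i + 1) = mulLin M k (g i) := by
    intro i hi
    rw [mulLin_projForm M (hhom i hi)]
    simp only [e]
    rw [pow_succ', mul_assoc, Nat.add_sub_add_right]
  have heN : ∀ i ≤ k, e i = mulLin N k (g i) := by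
    intro i hi
    rw [mulLin_projForm N (hhom i hi)]
    simp only [e]
    rw [Nat.succ_sub hi, pow_succ]
    congr 1
    ring
  have hzero : ∀ j i, j < i → i ≤ k + 1 → Λ j (e i) = 0 := by
    intro j
    induction j with
    | zero =>
      intro i hi hik
      obtain ⟨i, rfl⟩ := Nat.exists_eq_add_of_lt hi
      rw [show 0 + i + 1 = i + 1 by ring, heM i (by omega), h0]
    | succ j ih =>
      intro i hi hik
      obtain ⟨i, rfl⟩ : ∃ i', i = i' + 1 := ⟨i - 1, by omega⟩
      rw [heM i (by omega), h1, ← heN i (by omega), ih i (by omega) (by omega), neg_zero]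
  have hdiag : ∀ j ≤ k + 1, Λ j (e j) ≠ 0 := by
    intro j
    induction j with
    | zero => simpa [e] using hN
    | succ j ih =>
      intro hj
      rw [heM j (by omega), h1, ← heN j (by omega)]
      exact neg_ne_zero.2 (ih (by omega))
  let F : Dual ℂ (Forms m (k + 1)) →ₗ[ℂ] (Fin (k + 2) → ℂ) :=
    LinearMap.pi fun i => LinearMap.applyₗ (e i)
  apply LinearIndependent.of_comp F
  have hdet : (Matrix.of fun j i : Fin (k + 2) => Λ j (e i)).det ≠ 0 := by
    rw [Matrix.det_of_isLowerTriangular]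
    · exact Finset.prod_ne_zero_iff.2 fun i _ => hdiag i (by omega)
    · intro j i hij
      exact hzero _ _ hij (by omega)
  exact Matrix.linearIndependent_rows_of_det_ne_zero hdet

/-- A subspace of forms of degree `k + 1` of codimension at most `k + 1` restricts surjectively to
some hyperplane (a case of Green's hyperplane restriction theorem). -/
theorem exists_sup_range_mulLin_eq_top {m k : ℕ} (V : Submodule ℂ (Forms m (k + 1)))
    (hV : finrank ℂ (Forms m (k + 1) ⧸ V) ≤ k + 1) :
    ∃ a, V ⊔ LinearMap.range (mulLin a k) = ⊤ := by
  by_contra! hcon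
  let T : Fin m → Dual ℂ (Forms m (k + 1) ⧸ V) →ₗ[ℂ] Dual ℂ (Forms m k) := fun l =>
    (V.mkQ ∘ₗ mulLin (Pi.single l 1) k).dualMap
  have hT : ∀ a : Fin m → ℂ, ∑ l, a l • T l = (V.mkQ ∘ₗ mulLin a k).dualMap := by
    intro a
    ext μ u
    rw [mulLin_eq_sum]
    simp [T, LinearMap.sum_apply, map_sum]
  let b := finBasis ℂ (Dual ℂ (Forms m (k + 1) ⧸ V))
  obtain ⟨p, hp0, hp⟩ := exists_polynomial_family_mem_ker T b (by
    intro a hinj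
    rw [hT, LinearMap.dualMap_injective_iff] at hinj
    apply hcon a
    rw [eq_top_iff]
    intro x _
    obtain ⟨u, hu⟩ := hinj (V.mkQ x)
    rw [LinearMap.comp_apply, Submodule.mkQ_apply, Submodule.mkQ_apply, eq_comm,
      Submodule.Quotient.eq] at hu
    rw [← sub_add_cancel x (mulLin a k u)]
    exact Submodule.add_mem_sup hu ⟨u, rfl⟩)
  obtain ⟨M, hM⟩ : ∃ M, (fun i => eval M (p i)) ≠ 0 := by
    by_contra! h
    exact hp0 (funext fun i => MvPolynomial.funext fun x => by simpa using congrFun (h x) i)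
  have hb0 : ∑ i, eval M (p i) • b i ≠ 0 := fun h =>
    hM (funext fun i => Fintype.linearIndependent_iff.1 b.linearIndependent _ h i)
  obtain ⟨N, hN⟩ : ∃ N, (∑ i, eval M (p i) • b i)
      (V.mkQ (projForm m (k + 1) (linForm N ^ (k + 1)))) ≠ 0 := by
    by_contra! h
    apply hb0
    ext v
    have := eq_zero_of_linForm_pow (k + 1)
      ((∑ i, eval M (p i) • b i) ∘ₗ V.mkQ ∘ₗ projForm m (k + 1)) (fun a => h a) v.2
    rw [LinearMap.comp_apply, LinearMap.comp_apply, projForm_of_mem v.2] at this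
    simpa using this
  let q : Fin (finrank ℂ (Dual ℂ (Forms m (k + 1) ⧸ V))) → Polynomial ℂ := fun i =>
    aeval (fun l => Polynomial.C (M l) + Polynomial.X * Polynomial.C (N l)) (p i)
  have hq : ∀ i t, (q i).eval t = eval (M + t • N) (p i) := by
    intro i t
    have : (Polynomial.evalRingHom t).comp (aeval (fun l => Polynomial.C (M l) +
        Polynomial.X * Polynomial.C (N l)) : MvPolynomial (Fin m) ℂ →ₐ[ℂ] Polynomial ℂ).toRingHom =
        eval (M + t • N) := by
      apply MvPolynomial.ringHom_ext
      · intro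
        simp
      · intro
        simp
        ring
    exact congrArg (fun φ => φ (p i)) this
  let lam : ℕ → Dual ℂ (Forms m (k + 1) ⧸ V) := fun j => ∑ i, (q i).coeff j • b i
  have hker : ∀ u : Forms m k, ∑ i, q i * (Polynomial.C (b i (V.mkQ (mulLin M k u))) +
      Polynomial.X * Polynomial.C (b i (V.mkQ (mulLin N k u)))) = 0 := by
    intro u
    apply Polynomial.funext
    intro t
    have h := LinearMap.congr_fun (hp (M + t • N)) u
    rw [hT] at h
    simp only [LinearMap.dualMap_apply, LinearMap.comp_apply, mulLin_add_smul, map_add, map_smul,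
      LinearMap.sum_apply, LinearMap.smul_apply, LinearMap.zero_apply, smul_eq_mul] at h
    simp only [Polynomial.eval_finsetSum, Polynomial.eval_mul, Polynomial.eval_add,
      Polynomial.eval_C, Polynomial.eval_X, hq, Polynomial.eval_zero]
    rw [← h, Finset.mul_sum, ← Finset.sum_add_distrib]
    exact Finset.sum_congr rfl fun i _ => by ring
  have hli := linearIndependent_of_chain M N (fun j => (lam j) ∘ₗ V.mkQ)
    (fun u => by
      have := congrArg (fun r => r.coeff 0) (hker u)
      simpa [lam, LinearMap.sum_apply, Polynomial.finsetSum_coeff, mul_add] using this)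
    (fun j u => by
      have := congrArg (fun r => r.coeff (j + 1)) (hker u)
      simp only [mul_add, ← mul_assoc, mul_comm _ Polynomial.X, Polynomial.finsetSum_coeff,
        Polynomial.coeff_add, Polynomial.coeff_mul_C, Polynomial.coeff_X_mul,
        Polynomial.coeff_zero, Finset.sum_add_distrib] at this
      rw [eq_neg_iff_add_eq_zero]
      simpa [lam, LinearMap.sum_apply] using this)
    (by
      have hlam : lam 0 = ∑ i, eval M (p i) • b i := by
        refine Finset.sum_congr rfl fun i _ => ?_
        rw [Polynomial.coeff_zero_eq_eval_zero, hq, zero_smul, add_zero]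
      simpa [hlam] using hN)
  have hli' : LinearIndependent ℂ (fun j : Fin (k + 2) => lam j) :=
    LinearIndependent.of_comp (V.mkQ.dualMap) hli
  have := hli'.fintype_card_le_finrank
  rw [Subspace.dual_finrank_eq, Fintype.card_fin] at this
  omega

/-- Finitely many commuting endomorphisms of a nonzero finite-dimensional complex vector space have
a common eigenvector. -/
theorem exists_common_eigenvector {n : ℕ} {V : Type*} [AddCommGroup V] [Module ℂ V]
    [FiniteDimensional ℂ V] [Nontrivial V] (T : Fin n → Module.End ℂ V)
    (hT : ∀ i j, Commute (T i) (T j)) :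
    ∃ (v : V) (a : Fin n → ℂ), v ≠ 0 ∧ ∀ i, T i v = a i • v := by
  induction n generalizing V with
  | zero =>
    obtain ⟨v, hv⟩ := exists_ne (0 : V)
    exact ⟨v, Fin.elim0, hv, fun i => i.elim0⟩
  | succ n ih =>
    obtain ⟨μ, hμ⟩ := Module.End.exists_eigenvalue (T 0)
    let E := (T 0).eigenspace μ
    have hE : ∀ i : Fin n, ∀ x ∈ E, T i.succ x ∈ E := by
      intro i x hx
      rw [Module.End.mem_eigenspace_iff] at hx ⊢
      have := LinearMap.congr_fun (hT 0 i.succ) x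
      rw [Module.End.mul_apply, Module.End.mul_apply, hx, map_smul] at this
      exact this
    have : Nontrivial E := Submodule.nontrivial_iff_ne_bot.2 hμ
    obtain ⟨v, a, hv, ha⟩ := ih (fun i => (T i.succ).restrict (hE i)) (by
      intro i j
      ext x
      have := LinearMap.congr_fun (hT i.succ j.succ) x
      simpa using this)
    refine ⟨v, Fin.cons μ a, by simpa using hv, fun i => ?_⟩
    refine Fin.cases ?_ (fun i => ?_) i
    · simpa using Module.End.mem_eigenspace_iff.1 v.2
    · simpa using congrArg Subtype.val (ha i)

/-- The forms of degree `k` in the ideal `Q`. -/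
noncomputable def degPart {m : ℕ} (Q : Ideal (MvPolynomial (Fin m) ℂ)) (k : ℕ) :
    Submodule ℂ (Forms m k) :=
  Submodule.comap (homogeneousSubmodule (Fin m) ℂ k).subtype (Submodule.restrictScalars ℂ Q)

theorem mem_degPart {m k : ℕ} {Q : Ideal (MvPolynomial (Fin m) ℂ)} {p : Forms m k} :
    p ∈ degPart Q k ↔ (p : MvPolynomial (Fin m) ℂ) ∈ Q := Iff.rfl

theorem hilb_eq {m : ℕ} (Q : Ideal (MvPolynomial (Fin m) ℂ)) (k : ℕ) :
    hilb m Q k = finrank ℂ (Forms m k ⧸ degPart Q k) := rfl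

theorem hilb_le_of_forall_mem {m k : ℕ} {Q Q' : Ideal (MvPolynomial (Fin m) ℂ)}
    (h : ∀ p : MvPolynomial (Fin m) ℂ, p.IsHomogeneous k → p ∈ Q → p ∈ Q') :
    hilb m Q' k ≤ hilb m Q k := by
  have hle : degPart Q k ≤ degPart Q' k := fun p hp => h p p.2 hp
  exact LinearMap.finrank_le_finrank_of_surjective (f := Submodule.factor hle)
    (Submodule.factor_surjective hle)

theorem hilb_anti {m : ℕ} {Q Q' : Ideal (MvPolynomial (Fin m) ℂ)} (h : Q ≤ Q') (k : ℕ) :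
    hilb m Q' k ≤ hilb m Q k :=
  hilb_le_of_forall_mem fun _ _ hp => h hp

theorem hilb_eq_zero_iff {m k : ℕ} {Q : Ideal (MvPolynomial (Fin m) ℂ)} :
    hilb m Q k = 0 ↔ ∀ p : MvPolynomial (Fin m) ℂ, p.IsHomogeneous k → p ∈ Q := by
  rw [hilb_eq, Module.finrank_zero_iff, Submodule.Quotient.subsingleton_iff, eq_top_iff]
  exact ⟨fun h p hp => h (x := ⟨p, hp⟩) trivial, fun h p _ => h p p.2⟩

/-- Multiplication by a linear form on the graded pieces of the quotient by `Q`. -/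
noncomputable def quotMulLin {m : ℕ} (Q : Ideal (MvPolynomial (Fin m) ℂ)) (a : Fin m → ℂ) (k : ℕ) :
    (Forms m k ⧸ degPart Q k) →ₗ[ℂ] (Forms m (k + 1) ⧸ degPart Q (k + 1)) :=
  (degPart Q k).mapQ (degPart Q (k + 1)) (mulLin a k) fun _ hp => Q.mul_mem_left _ hp

@[simp]
theorem quotMulLin_mkQ {m k : ℕ} (Q : Ideal (MvPolynomial (Fin m) ℂ)) (a : Fin m → ℂ)
    (p : Forms m k) :
    quotMulLin Q a k ((degPart Q k).mkQ p) = (degPart Q (k + 1)).mkQ (mulLin a k p) := rfl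

theorem quotMulLin_surjective {m k : ℕ} {Q : Ideal (MvPolynomial (Fin m) ℂ)} {a : Fin m → ℂ}
    (h : degPart Q (k + 1) ⊔ LinearMap.range (mulLin a k) = ⊤) :
    Function.Surjective (quotMulLin Q a k) := by
  intro x
  obtain ⟨p, rfl⟩ := Submodule.mkQ_surjective _ x
  obtain ⟨v, hv, w, ⟨u, rfl⟩, rfl⟩ := Submodule.mem_sup.1 (h ▸ Submodule.mem_top : p ∈ _)
  refine ⟨(degPart Q k).mkQ u, ?_⟩
  rw [quotMulLin_mkQ, map_add, (Submodule.Quotient.mk_eq_zero _).2 hv |> fun h' => (h' :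
    (degPart Q (k + 1)).mkQ v = 0), zero_add]

theorem exists_forms_sum {m k : ℕ} (p : Forms m (k + 1)) :
    ∃ u : Fin m → Forms m k, p = ∑ i, mulLin (Pi.single i 1) k (u i) := by
  obtain ⟨u, hu, h⟩ := p.2.exists_sum_X_mul
  refine ⟨fun i => ⟨u i, hu i⟩, Subtype.ext ?_⟩
  simp only [Submodule.coe_sum, coe_mulLin, linForm_single, h]

theorem mulLin_comm {m k : ℕ} (a b : Fin m → ℂ) (p : Forms m k) :
    mulLin a (k + 1) (mulLin b k p) = mulLin b (k + 1) (mulLin a k p) :=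
  Subtype.ext (by simp only [coe_mulLin]; ring)

theorem quotMulLin_comm {m k : ℕ} (Q : Ideal (MvPolynomial (Fin m) ℂ)) (a b : Fin m → ℂ)
    (x : Forms m k ⧸ degPart Q k) :
    quotMulLin Q a (k + 1) (quotMulLin Q b k x) = quotMulLin Q b (k + 1) (quotMulLin Q a k x) := by
  obtain ⟨p, rfl⟩ := Submodule.mkQ_surjective _ x
  simp only [quotMulLin_mkQ, mulLin_comm a b]

theorem exists_sum_quotMulLin {m k : ℕ} (Q : Ideal (MvPolynomial (Fin m) ℂ))
    (x : Forms m (k + 1) ⧸ degPart Q (k + 1)) :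
    ∃ u : Fin m → Forms m k ⧸ degPart Q k, x = ∑ i, quotMulLin Q (Pi.single i 1) k (u i) := by
  obtain ⟨p, rfl⟩ := Submodule.mkQ_surjective _ x
  obtain ⟨u, rfl⟩ := exists_forms_sum p
  exact ⟨fun i => (degPart Q k).mkQ (u i), by simp only [quotMulLin_mkQ, map_sum]⟩

theorem quotMulLin_succ_surjective {m k : ℕ} {Q : Ideal (MvPolynomial (Fin m) ℂ)} {a : Fin m → ℂ}
    (h : Function.Surjective (quotMulLin Q a k)) :
    Function.Surjective (quotMulLin Q a (k + 1)) := by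
  intro x
  obtain ⟨u, rfl⟩ := exists_sum_quotMulLin Q x
  choose w hw using fun i => h (u i)
  refine ⟨∑ i, quotMulLin Q (Pi.single i 1) k (w i), ?_⟩
  simp only [map_sum, quotMulLin_comm Q a, hw]

/-- If the Hilbert function is at most `k + 1` in degree `k + 1`, then multiplication by some linear
form is surjective from degree `k` on. -/
theorem exists_quotMulLin_surjective {m k : ℕ} {Q : Ideal (MvPolynomial (Fin m) ℂ)}
    (h : hilb m Q (k + 1) ≤ k + 1) : ∃ a, Function.Surjective (quotMulLin Q a k) := by
  obtain ⟨a, ha⟩ := exists_sup_range_mulLin_eq_top (degPart Q (k + 1)) h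
  exact ⟨a, quotMulLin_surjective ha⟩

theorem hilb_succ_eq_zero {m k : ℕ} {Q : Ideal (MvPolynomial (Fin m) ℂ)} (h : hilb m Q k = 0) :
    hilb m Q (k + 1) = 0 := by
  rw [hilb_eq_zero_iff] at h ⊢
  intro p hp
  obtain ⟨u, hu, rfl⟩ := hp.exists_sum_X_mul
  exact Q.sum_mem fun i _ => Q.mul_mem_left _ (h _ (hu i))

/-- A case of Macaulay's bound on the growth of Hilbert functions. -/
theorem hilb_succ_le {m k : ℕ} {Q : Ideal (MvPolynomial (Fin m) ℂ)} (h : hilb m Q k ≤ k) :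
    hilb m Q (k + 1) ≤ hilb m Q k := by
  cases k with
  | zero => simp [hilb_succ_eq_zero (Nat.le_zero.1 h)]
  | succ k =>
    obtain ⟨a, ha⟩ := exists_quotMulLin_surjective h
    exact LinearMap.finrank_le_finrank_of_surjective (quotMulLin_succ_surjective ha)

/-- A functional on forms of degree `n` for which multiplication by `X i` is `a i` times
multiplication by a fixed linear form is a multiple of the evaluation at `a`. -/
theorem eq_eval_mul_of_forall_X_mul {m n : ℕ} (b a : Fin m → ℂ)
    (Λ : MvPolynomial (Fin m) ℂ →ₗ[ℂ] ℂ)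
    (h : ∀ i (u : MvPolynomial (Fin m) ℂ), u.IsHomogeneous n →
      Λ (X i * u) = a i * Λ (linForm b * u)) {j : ℕ} (hj : j ≤ n + 1)
    {p : MvPolynomial (Fin m) ℂ} (hp : p.IsHomogeneous j) :
    Λ (linForm b ^ (n + 1 - j) * p) = eval a p * Λ (linForm b ^ (n + 1)) := by
  induction j generalizing p with
  | zero =>
    have h1 := totalDegree_eq_zero_iff_eq_C.1 ((totalDegree_zero_iff_isHomogeneous _).2 hp)
    rw [h1, mul_comm, ← smul_eq_C_mul, map_smul, eval_C, smul_eq_mul, Nat.sub_zero]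
  | succ j ih =>
    obtain ⟨u, hu, rfl⟩ := hp.exists_sum_X_mul
    simp only [Finset.mul_sum, map_sum, Finset.sum_mul]
    refine Finset.sum_congr rfl fun i _ => ?_
    have hhom : (linForm b ^ (n - j) * u i).IsHomogeneous n := by
      have := ((linForm_isHomogeneous b).pow (n - j)).mul (hu i)
      rwa [one_mul, Nat.sub_add_cancel (by omega)] at this
    have h1 := h i _ hhom
    have h2 := ih (by omega) (hu i)
    rw [Nat.add_sub_add_right, mul_left_comm, h1, ← mul_assoc (linForm b), ← pow_succ',
      show n - j + 1 = n + 1 - j by omega, h2, map_mul, eval_X, mul_assoc]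

/-- A case of Gotzmann's persistence theorem: if the Hilbert function is small, nonzero and does
not drop from degree `k` to `k + 1`, then the forms of degree at most `k + 1` in the ideal have a
common zero. -/
theorem exists_common_zero {m k : ℕ} {Q : Ideal (MvPolynomial (Fin m) ℂ)}
    (h : hilb m Q k ≤ k) (h0 : hilb m Q k ≠ 0) (hle : hilb m Q k ≤ hilb m Q (k + 1)) :
    ∃ x : Fin m → ℂ, x ≠ 0 ∧ ∀ j ≤ k + 1, ∀ p ∈ Q, p.IsHomogeneous j → eval x p = 0 := by
  cases k with
  | zero => exact absurd (Nat.le_zero.1 h) h0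
  | succ k =>
    obtain ⟨b, hb⟩ := exists_quotMulLin_surjective h
    have heq : finrank ℂ (Forms m (k + 1) ⧸ degPart Q (k + 1)) =
        finrank ℂ (Forms m (k + 1 + 1) ⧸ degPart Q (k + 1 + 1)) :=
      le_antisymm hle (hilb_succ_le h)
    have hsurj := quotMulLin_succ_surjective hb
    have hbij : Function.Bijective (quotMulLin Q b (k + 1)) :=
      ⟨(LinearMap.injective_iff_surjective_of_finrank_eq_finrank heq).2 hsurj, hsurj⟩
    let μ := LinearEquiv.ofBijective _ hbij
    have hμ : ∀ x, μ.symm (quotMulLin Q b (k + 1) x) = x := fun x => μ.symm_apply_apply x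
    let ξ : Fin m → Module.End ℂ (Forms m (k + 1) ⧸ degPart Q (k + 1)) := fun i =>
      μ.symm.toLinearMap ∘ₗ quotMulLin Q (Pi.single i 1) (k + 1)
    have hξ : ∀ i x, ξ i (quotMulLin Q b k x) = quotMulLin Q (Pi.single i 1) k x := by
      intro i x
      change μ.symm (quotMulLin Q _ (k + 1) (quotMulLin Q b k x)) = _
      rw [quotMulLin_comm, hμ]
    have hcomm : ∀ i j, Commute (ξ i) (ξ j) := by
      intro i j
      refine LinearMap.ext fun x => ?_
      obtain ⟨y, rfl⟩ := hb x
      rw [Module.End.mul_apply, Module.End.mul_apply, hξ, hξ]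
      change μ.symm (quotMulLin Q _ (k + 1) _) = μ.symm (quotMulLin Q _ (k + 1) _)
      rw [quotMulLin_comm]
    have hnt : Nontrivial (Forms m (k + 1) ⧸ degPart Q (k + 1)) :=
      not_subsingleton_iff_nontrivial.1 fun hs => h0 (Module.finrank_zero_iff.2 hs)
    obtain ⟨lam, a, hlam, ha⟩ := exists_common_eigenvector
      (V := Dual ℂ (Forms m (k + 1) ⧸ degPart Q (k + 1))) (fun i => (ξ i).dualMap) (by
        intro i j
        refine LinearMap.ext fun l => LinearMap.ext fun x => ?_
        exact congrArg l (LinearMap.congr_fun (hcomm j i) x))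
    let Λ : MvPolynomial (Fin m) ℂ →ₗ[ℂ] ℂ :=
      lam ∘ₗ μ.symm.toLinearMap ∘ₗ (degPart Q (k + 1 + 1)).mkQ ∘ₗ projForm m (k + 1 + 1)
    have hΛ : ∀ (c : Fin m → ℂ) (u : Forms m (k + 1)), Λ (linForm c * u) =
        lam (μ.symm (quotMulLin Q c (k + 1) ((degPart Q (k + 1)).mkQ u))) := by
      intro c u
      rw [quotMulLin_mkQ]
      simp only [Λ, LinearMap.comp_apply, LinearEquiv.coe_coe]
      rw [← mulLin_projForm c u.2, projForm_of_mem u.2]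
    have hX : ∀ i (u : MvPolynomial (Fin m) ℂ), u.IsHomogeneous (k + 1) →
        Λ (X i * u) = a i * Λ (linForm b * u) := by
      intro i u hu
      have h1 := hΛ (Pi.single i 1) ⟨u, hu⟩
      have h2 := hΛ b ⟨u, hu⟩
      rw [hμ] at h2
      rw [linForm_single] at h1
      rw [h1, h2]
      exact LinearMap.congr_fun (ha i) _
    have hker : ∀ p ∈ Q, p.IsHomogeneous (k + 1 + 1) → Λ p = 0 := by
      intro p hp hp'
      simp only [Λ, LinearMap.comp_apply]
      have hz : (degPart Q (k + 1 + 1)).mkQ (projForm m (k + 1 + 1) p) = 0 := by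
        rw [projForm_of_mem hp']
        exact (Submodule.Quotient.mk_eq_zero _).2 hp
      rw [hz, map_zero, map_zero]
    have hne : Λ (linForm b ^ (k + 1 + 1)) ≠ 0 := by
      intro hz
      apply hlam
      ext u
      have h2 := hΛ b u
      rw [hμ] at h2
      have hp : (linForm b * (u : MvPolynomial (Fin m) ℂ)).IsHomogeneous (k + 1 + 1) := by
        rw [add_comm (k + 1)]
        exact (linForm_isHomogeneous b).mul u.2
      have h3 := eq_eval_mul_of_forall_X_mul b a Λ hX le_rfl hp
      rw [hz, mul_zero, Nat.sub_self, pow_zero, one_mul, h2] at h3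
      simpa using h3
    have hzero : ∀ j ≤ k + 1 + 1, ∀ p ∈ Q, p.IsHomogeneous j → eval a p = 0 := by
      intro j hj p hp hp'
      have h1 := eq_eval_mul_of_forall_X_mul b a Λ hX hj hp'
      rw [hker _ (Q.mul_mem_left _ hp)] at h1
      · exact (mul_eq_zero.1 h1.symm).resolve_right hne
      · have := ((linForm_isHomogeneous b).pow (k + 1 + 1 - j)).mul hp'
        rwa [one_mul, Nat.sub_add_cancel hj] at this
    refine ⟨a, ?_, hzero⟩
    rintro rfl
    have h1 := eq_eval_mul_of_forall_X_mul b 0 Λ hX (j := 1) (by omega) (linForm_isHomogeneous b)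
    rw [← pow_succ, Nat.sub_add_cancel (by omega), eval_linForm] at h1
    simp only [Pi.zero_apply, mul_zero, Finset.sum_const_zero, zero_mul] at h1
    exact hne h1

theorem mkQ_degPart_eq_zero_iff {m k : ℕ} {Q : Ideal (MvPolynomial (Fin m) ℂ)} {p : Forms m k} :
    (degPart Q k).mkQ p = 0 ↔ (p : MvPolynomial (Fin m) ℂ) ∈ Q :=
  Submodule.Quotient.mk_eq_zero (degPart Q k)

theorem mem_of_hilb_le {m k : ℕ} {Q Q' : Ideal (MvPolynomial (Fin m) ℂ)} (hQ : Q ≤ Q')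
    (h : hilb m Q k ≤ hilb m Q' k) {p : MvPolynomial (Fin m) ℂ} (hp : p.IsHomogeneous k)
    (hpQ : p ∈ Q') : p ∈ Q := by
  have hle : degPart Q k ≤ degPart Q' k := fun p hp => hQ hp
  have heq : finrank ℂ (Forms m k ⧸ degPart Q k) = finrank ℂ (Forms m k ⧸ degPart Q' k) :=
    le_antisymm h (hilb_anti hQ k)
  have hinj := (LinearMap.injective_iff_surjective_of_finrank_eq_finrank heq
    (f := Submodule.factor hle)).2 (Submodule.factor_surjective hle)
  have h1 : Submodule.factor hle ((degPart Q k).mkQ ⟨p, hp⟩) = 0 :=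
    mkQ_degPart_eq_zero_iff.2 hpQ
  exact mkQ_degPart_eq_zero_iff.1 (hinj (h1.trans (map_zero _).symm))

theorem hilb_sup_span_lt {m k : ℕ} {Q : Ideal (MvPolynomial (Fin m) ℂ)}
    {p : MvPolynomial (Fin m) ℂ} (hp : p.IsHomogeneous k) (hpQ : p ∉ Q) :
    hilb m (Q ⊔ Ideal.span {p}) k < hilb m Q k := by
  by_contra! h
  exact hpQ (mem_of_hilb_le le_sup_left h hp
    (Ideal.mem_sup_right (Ideal.mem_span_singleton_self p)))

/-- The homogeneous components of a multiple of a form are multiples of that form. -/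
theorem MvPolynomial.IsHomogeneous.exists_homogeneousComponent_mul {m j : ℕ}
    {p : MvPolynomial (Fin m) ℂ} (hp : p.IsHomogeneous j) (a : MvPolynomial (Fin m) ℂ) (n : ℕ) :
    ∃ b : MvPolynomial (Fin m) ℂ, b.IsHomogeneous (n - j) ∧ (n < j → b = 0) ∧
      homogeneousComponent n (p * a) = p * b := by
  refine ⟨∑ i ∈ Finset.range (a.totalDegree + 1),
    if n = j + i then homogeneousComponent i a else 0, ?_, ?_, ?_⟩
  · refine IsHomogeneous.sum _ _ _ fun i _ => ?_
    split_ifs with h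
    · rw [h, Nat.add_sub_cancel_left]
      exact homogeneousComponent_isHomogeneous i a
    · exact isHomogeneous_zero _ _ _
  · exact fun h => Finset.sum_eq_zero fun i _ => if_neg (by omega)
  · conv_lhs => rw [← sum_homogeneousComponent a]
    rw [Finset.mul_sum, map_sum, Finset.mul_sum]
    refine Finset.sum_congr rfl fun i _ => ?_
    rw [homogeneousComponent_of_mem (hp.mul (homogeneousComponent_isHomogeneous i a)), mul_ite,
      mul_zero]

theorem exists_homogeneous_of_mem_sup_span {m j k : ℕ} {Q : Ideal (MvPolynomial (Fin m) ℂ)}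
    (hQ : Q.IsHomogeneous (homogeneousSubmodule (Fin m) ℂ)) {p F : MvPolynomial (Fin m) ℂ}
    (hp : p.IsHomogeneous j) (hF : F.IsHomogeneous k) (hFQ : F ∈ Q ⊔ Ideal.span {p}) :
    ∃ q ∈ Q, ∃ b : MvPolynomial (Fin m) ℂ, q.IsHomogeneous k ∧ b.IsHomogeneous (k - j) ∧
      (k < j → b = 0) ∧ F = q + p * b := by
  obtain ⟨q, hq, r, hr, rfl⟩ := Submodule.mem_sup.1 hFQ
  obtain ⟨a, rfl⟩ := Ideal.mem_span_singleton'.1 hr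
  obtain ⟨b, hb, hb0, hb1⟩ := hp.exists_homogeneousComponent_mul a k
  refine ⟨_, homogeneousComponent_mem_of_mem hQ hq k, b, homogeneousComponent_isHomogeneous _ _,
    hb, hb0, ?_⟩
  rw [← hb1, ← map_add, mul_comm p, homogeneousComponent_eq_self hF]

theorem isHomogeneous_sup_span {m j : ℕ} {Q : Ideal (MvPolynomial (Fin m) ℂ)}
    (hQ : Q.IsHomogeneous (homogeneousSubmodule (Fin m) ℂ)) {p : MvPolynomial (Fin m) ℂ}
    (hp : p.IsHomogeneous j) :
    (Q ⊔ Ideal.span {p}).IsHomogeneous (homogeneousSubmodule (Fin m) ℂ) :=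
  hQ.sup (Ideal.homogeneous_span _ _ fun _ hx => ⟨j, (Set.mem_singleton_iff.1 hx) ▸ hp⟩)

theorem hilb_sup_span_linForm_add {m : ℕ} {Q : Ideal (MvPolynomial (Fin m) ℂ)}
    (hQ : Q.IsHomogeneous (homogeneousSubmodule (Fin m) ℂ)) (a : Fin m → ℂ) (k : ℕ) :
    finrank ℂ (LinearMap.range (quotMulLin Q a k)) +
      hilb m (Q ⊔ Ideal.span {linForm a}) (k + 1) = hilb m Q (k + 1) := by
  have hle : degPart Q (k + 1) ≤ degPart (Q ⊔ Ideal.span {linForm a}) (k + 1) :=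
    fun p hp => Ideal.mem_sup_left hp
  have hker : LinearMap.ker (Submodule.factor hle) = LinearMap.range (quotMulLin Q a k) := by
    ext x
    obtain ⟨p, rfl⟩ := Submodule.mkQ_surjective _ x
    constructor
    · intro h
      have hp : (p : MvPolynomial (Fin m) ℂ) ∈ Q ⊔ Ideal.span {linForm a} :=
        mkQ_degPart_eq_zero_iff.1 h
      obtain ⟨q, hq, b, hqk, hb, -, hpe⟩ :=
        exists_homogeneous_of_mem_sup_span hQ (linForm_isHomogeneous a) p.2 hp
      refine ⟨(degPart Q k).mkQ ⟨b, hb⟩, ?_⟩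
      rw [quotMulLin_mkQ]
      refine (Submodule.Quotient.eq' _).2 ?_
      rw [mem_degPart]
      simpa [hpe] using hq
    · rintro ⟨y, hy⟩
      obtain ⟨u, rfl⟩ := Submodule.mkQ_surjective _ y
      rw [← hy]
      exact (Submodule.Quotient.mk_eq_zero _).2
        (Ideal.mem_sup_right (Ideal.mul_mem_right _ _ (Ideal.mem_span_singleton_self _)))
  have h := LinearMap.finrank_range_add_finrank_ker (Submodule.factor hle)
  rw [hker, LinearMap.range_eq_top.2 (Submodule.factor_surjective hle), finrank_top, add_comm] at h
  exact h

theorem hilb_succ_le_add {m : ℕ} {Q : Ideal (MvPolynomial (Fin m) ℂ)}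
    (hQ : Q.IsHomogeneous (homogeneousSubmodule (Fin m) ℂ)) (a : Fin m → ℂ) (k : ℕ) :
    hilb m Q (k + 1) ≤ hilb m Q k + hilb m (Q ⊔ Ideal.span {linForm a}) (k + 1) := by
  rw [← hilb_sup_span_linForm_add hQ a k]
  exact Nat.add_le_add_right (LinearMap.finrank_range_le _) _

/-- The Hilbert function of a hyperplane section by a nonzerodivisor. -/
theorem hilb_succ_eq_add {m : ℕ} {Q : Ideal (MvPolynomial (Fin m) ℂ)}
    (hQ : Q.IsHomogeneous (homogeneousSubmodule (Fin m) ℂ)) {a : Fin m → ℂ} {k : ℕ}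
    (h : ∀ p : MvPolynomial (Fin m) ℂ, p.IsHomogeneous k → linForm a * p ∈ Q → p ∈ Q) :
    hilb m Q (k + 1) = hilb m Q k + hilb m (Q ⊔ Ideal.span {linForm a}) (k + 1) := by
  suffices hinj : Function.Injective (quotMulLin Q a k) by
    rw [← hilb_sup_span_linForm_add hQ a k, LinearMap.finrank_range_of_inj hinj, hilb_eq Q k]
  rw [← LinearMap.ker_eq_bot, LinearMap.ker_eq_bot']
  intro x hx
  obtain ⟨p, rfl⟩ := Submodule.mkQ_surjective _ x
  rw [quotMulLin_mkQ] at hx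
  exact mkQ_degPart_eq_zero_iff.2 (h p p.2 (mkQ_degPart_eq_zero_iff.1 hx))

theorem hilb_zero_le {m : ℕ} (Q : Ideal (MvPolynomial (Fin m) ℂ)) : hilb m Q 0 ≤ 1 := by
  rw [hilb_eq]
  let o : Forms m 0 := ⟨1, isHomogeneous_one _ _⟩
  refine finrank_le_one ((degPart Q 0).mkQ o) fun x => ?_
  obtain ⟨⟨p, hp⟩, rfl⟩ := Submodule.mkQ_surjective _ x
  have h1 := totalDegree_eq_zero_iff_eq_C.1 ((totalDegree_zero_iff_isHomogeneous _).2 hp)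
  refine ⟨coeff 0 p, ?_⟩
  rw [← map_smul]
  congr 1
  exact Subtype.ext (Eq.trans (by simp [o, smul_eq_C_mul]) h1.symm)

theorem hilb_one_le {m : ℕ} (Q : Ideal (MvPolynomial (Fin m) ℂ)) : hilb m Q 1 ≤ m := by
  let φ : (Fin m → ℂ) →ₗ[ℂ] Forms m 1 ⧸ degPart Q 1 :=
    (degPart Q 1).mkQ ∘ₗ Fintype.linearCombination ℂ fun i => ⟨X i, isHomogeneous_X _ _⟩
  have hφ : Function.Surjective φ := by
    intro x
    obtain ⟨⟨p, hp⟩, rfl⟩ := Submodule.mkQ_surjective _ x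
    obtain ⟨a, rfl⟩ := exists_linForm_eq hp
    refine ⟨a, congrArg (degPart Q 1).mkQ (Subtype.ext ?_)⟩
    simp [Fintype.linearCombination_apply, linForm, smul_eq_C_mul]
  simpa [hilb_eq] using LinearMap.finrank_le_finrank_of_surjective hφ

/-- The Hilbert function of an ideal containing all but two linear forms. -/
theorem hilb_le_succ {m : ℕ} {Q : Ideal (MvPolynomial (Fin m) ℂ)}
    (hQ : Q.IsHomogeneous (homogeneousSubmodule (Fin m) ℂ)) (h : hilb m Q 1 ≤ 2) (k : ℕ) :
    hilb m Q k ≤ k + 1 := by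
  obtain ⟨a, ha⟩ : ∃ a : Fin m → ℂ, hilb m (Q ⊔ Ideal.span {linForm a}) 1 ≤ 1 := by
    by_cases hall : ∀ a : Fin m → ℂ, linForm a ∈ Q
    · refine ⟨0, ((hilb_anti le_sup_left 1).trans_eq (hilb_eq_zero_iff.2 fun p hp => ?_)).trans
        zero_le_one⟩
      obtain ⟨a, rfl⟩ := exists_linForm_eq hp
      exact hall a
    · push Not at hall
      obtain ⟨a, ha⟩ := hall
      have := hilb_sup_span_lt (linForm_isHomogeneous a) ha
      exact ⟨a, by omega⟩
  have h1 : ∀ j, hilb m (Q ⊔ Ideal.span {linForm a}) (j + 1) ≤ 1 := by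
    intro j
    induction j with
    | zero => exact ha
    | succ j ih => exact (hilb_succ_le (by omega)).trans ih
  induction k with
  | zero => exact hilb_zero_le Q
  | succ k ih =>
    have := hilb_succ_le_add hQ a k
    have := h1 k
    omega

theorem MvPolynomial.IsHomogeneous.eval_smul {m k : ℕ} {p : MvPolynomial (Fin m) ℂ}
    (hp : p.IsHomogeneous k) (t : ℂ) (x : Fin m → ℂ) : eval (t • x) p = t ^ k * eval x p := by
  rw [eval_eq, eval_eq, Finset.mul_sum]
  refine Finset.sum_congr rfl fun c hc => ?_
  have hdeg := hp (mem_support_iff.1 hc)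
  rw [Finsupp.weight_apply] at hdeg
  simp only [Pi.smul_apply, smul_eq_mul, mul_pow, Finset.prod_mul_distrib]
  rw [Finset.prod_pow_eq_pow_sum, mul_left_comm]
  congr 2
  simpa [Finsupp.sum] using hdeg

theorem mem_coneVanishingIdeal {m : ℕ} {S : Set (Projectivization ℂ (Fin m → ℂ))}
    {p : MvPolynomial (Fin m) ℂ} :
    p ∈ coneVanishingIdeal m S ↔ ∀ P ∈ S, ∀ t : ℂ, eval (t • P.rep) p = 0 := by
  refine ⟨fun h => ?_, fun h => Ideal.subset_span h⟩
  induction h using Submodule.span_induction with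
  | mem x hx => exact hx
  | zero => simp
  | add x y _ _ hx hy => exact fun P hP t => by rw [map_add, hx P hP, hy P hP, add_zero]
  | smul a x _ hx => exact fun P hP t => by rw [smul_eq_mul, map_mul, hx P hP, mul_zero]

theorem mem_coneVanishingIdeal_of_isHomogeneous {m k : ℕ}
    {S : Set (Projectivization ℂ (Fin m → ℂ))} {p : MvPolynomial (Fin m) ℂ}
    (hp : p.IsHomogeneous k) :
    p ∈ coneVanishingIdeal m S ↔ ∀ P ∈ S, eval P.rep p = 0 := by
  rw [mem_coneVanishingIdeal]
  refine ⟨fun h P hP => by simpa using h P hP 1, fun h P hP t => ?_⟩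
  rw [hp.eval_smul, h P hP, mul_zero]

theorem isHomogeneous_coneVanishingIdeal {m : ℕ} (S : Set (Projectivization ℂ (Fin m → ℂ))) :
    (coneVanishingIdeal m S).IsHomogeneous (homogeneousSubmodule (Fin m) ℂ) := by
  intro n p hp
  rw [show (DirectSum.decompose (homogeneousSubmodule (Fin m) ℂ) p n : MvPolynomial (Fin m) ℂ) =
    homogeneousComponent n p from decomposition.decompose'_apply p n,
    mem_coneVanishingIdeal_of_isHomogeneous (homogeneousComponent_isHomogeneous n p)]
  intro P hP
  rw [mem_coneVanishingIdeal] at hp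
  let q : Polynomial ℂ := ∑ i ∈ Finset.range (p.totalDegree + 1),
    Polynomial.monomial i (eval P.rep (homogeneousComponent i p))
  have hq : q = 0 := by
    refine Polynomial.funext fun t => ?_
    rw [Polynomial.eval_zero, ← hp P hP t]
    conv_rhs => rw [← sum_homogeneousComponent p]
    rw [Polynomial.eval_finsetSum, map_sum]
    refine Finset.sum_congr rfl fun i _ => ?_
    rw [(homogeneousComponent_isHomogeneous i p).eval_smul, Polynomial.eval_monomial, mul_comm]
  by_cases hn : p.totalDegree < n
  · rw [homogeneousComponent_eq_zero n p hn, map_zero]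
  · have := congrArg (fun r : Polynomial ℂ => r.coeff n) hq
    simpa [q, Polynomial.finsetSum_coeff, Polynomial.coeff_monomial, Nat.lt_succ_iff,
      not_lt.1 hn] using this

theorem linForm_mul_mem_coneVanishingIdeal {m k : ℕ} {S : Set (Projectivization ℂ (Fin m → ℂ))}
    {v : Fin m → ℂ} (hv : ∀ P ∈ S, eval P.rep (linForm v) ≠ 0) {p : MvPolynomial (Fin m) ℂ}
    (hp : p.IsHomogeneous k) (h : linForm v * p ∈ coneVanishingIdeal m S) :
    p ∈ coneVanishingIdeal m S := by
  rw [mem_coneVanishingIdeal_of_isHomogeneous ((linForm_isHomogeneous v).mul hp)] at h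
  rw [mem_coneVanishingIdeal_of_isHomogeneous hp]
  intro P hP
  have := h P hP
  rw [map_mul] at this
  exact (mul_eq_zero.1 this).resolve_left (hv P hP)

/-- Some linear form vanishes at no point of a given finite set. -/
theorem exists_linForm_eval_ne_zero {m : ℕ} {S : Set (Projectivization ℂ (Fin m → ℂ))}
    (hS : S.Finite) : ∃ v : Fin m → ℂ, ∀ P ∈ S, eval P.rep (linForm v) ≠ 0 := by
  have hne : ∏ P ∈ hS.toFinset, linForm P.rep ≠ 0 := by
    refine Finset.prod_ne_zero_iff.2 fun P _ h => P.rep_nonzero (funext fun i => ?_)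
    have := congrArg (eval (Pi.single i 1)) h
    rw [eval_linForm, map_zero] at this
    simpa [Pi.single_apply] using this
  obtain ⟨v, hv⟩ : ∃ v : Fin m → ℂ, eval v (∏ P ∈ hS.toFinset, linForm P.rep) ≠ 0 := by
    by_contra! h
    exact hne (MvPolynomial.funext fun v => by rw [h v, map_zero])
  rw [map_prod, Finset.prod_ne_zero_iff] at hv
  refine ⟨v, fun P hP => ?_⟩
  have := hv P (hS.mem_toFinset.2 hP)
  rw [eval_linForm] at this ⊢
  simpa only [mul_comm] using this

/-- Evaluation of forms of degree `k` at the points of `S`. -/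
noncomputable def evalForms {m : ℕ} (S : Set (Projectivization ℂ (Fin m → ℂ))) (k : ℕ) :
    Forms m k →ₗ[ℂ] (S → ℂ) :=
  LinearMap.pi fun P => (aeval (R := ℂ) P.1.rep).toLinearMap ∘ₗ
    (homogeneousSubmodule (Fin m) ℂ k).subtype

theorem evalForms_apply {m k : ℕ} (S : Set (Projectivization ℂ (Fin m → ℂ))) (p : Forms m k)
    (P : S) : evalForms S k p P = eval P.1.rep (p : MvPolynomial (Fin m) ℂ) := by
  simp [evalForms, aeval_eq_eval]

theorem hilb_coneVanishingIdeal {m : ℕ} (S : Set (Projectivization ℂ (Fin m → ℂ))) (k : ℕ) :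
    hilb m (coneVanishingIdeal m S) k = finrank ℂ (LinearMap.range (evalForms S k)) := by
  have hker : LinearMap.ker (evalForms S k) = degPart (coneVanishingIdeal m S) k := by
    ext p
    rw [mem_degPart, mem_coneVanishingIdeal_of_isHomogeneous p.2, LinearMap.mem_ker, funext_iff]
    simp only [evalForms_apply, Subtype.forall, Pi.zero_apply]
  have h := (evalForms S k).quotKerEquivRange.finrank_eq
  rwa [hker] at h

theorem hilb_coneVanishingIdeal_le {m : ℕ} {S : Set (Projectivization ℂ (Fin m → ℂ))}
    (hS : S.Finite) (k : ℕ) : hilb m (coneVanishingIdeal m S) k ≤ S.ncard := by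
  have := hS.fintype
  rw [hilb_coneVanishingIdeal]
  refine (Submodule.finrank_le _).trans_eq ?_
  rw [Module.finrank_fintype_fun_eq_card, Set.ncard_eq_toFinset_card', Set.toFinset_card]

theorem exists_isHomogeneous_one_separating {m : ℕ} {P Q : Projectivization ℂ (Fin m → ℂ)}
    (h : Q ≠ P) : ∃ p : MvPolynomial (Fin m) ℂ, p.IsHomogeneous 1 ∧ eval P.rep p ≠ 0 ∧
      eval Q.rep p = 0 := by
  obtain ⟨i, hi⟩ := Function.ne_iff.1 Q.rep_nonzero
  by_contra! hcon
  apply h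
  have hlin : ∀ j, Q.rep i * P.rep j = Q.rep j * P.rep i := by
    intro j
    have h1 : (C (Q.rep i) * X j - C (Q.rep j) * X i : MvPolynomial (Fin m) ℂ).IsHomogeneous 1 :=
      (isHomogeneous_C_mul_X _ _).sub (isHomogeneous_C_mul_X _ _)
    by_contra hne
    refine hcon _ h1 ?_ ?_
    · simpa [sub_eq_zero] using hne
    · simp [mul_comm]
  rw [← P.mk_rep, ← Q.mk_rep, eq_comm, Projectivization.mk_eq_mk_iff']
  refine ⟨P.rep i / Q.rep i, funext fun j => ?_⟩
  have hi' : Q.rep i ≠ 0 := hi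
  rw [Pi.smul_apply, smul_eq_mul]
  field_simp
  linear_combination - hlin j

/-- Forms of degree `|S| - 1` separate the points of `S`. -/
theorem hilb_coneVanishingIdeal_ncard_sub_one {m : ℕ} {S : Set (Projectivization ℂ (Fin m → ℂ))}
    (hS : S.Finite) : hilb m (coneVanishingIdeal m S) (S.ncard - 1) = S.ncard := by
  classical
  have := hS.fintype
  have hsurj : LinearMap.range (evalForms S (S.ncard - 1)) = ⊤ := by
    rw [eq_top_iff, ← (Pi.basisFun ℂ S).span_eq, Submodule.span_le]
    rintro _ ⟨P, rfl⟩
    choose p hp hP hQ using fun Q : {Q : S // Q ≠ P} =>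
      exists_isHomogeneous_one_separating (fun h => Q.2 (Subtype.ext h) : Q.1.1 ≠ P.1)
    have hhom : (∏ Q, p Q).IsHomogeneous (S.ncard - 1) := by
      have := IsHomogeneous.prod Finset.univ p (fun _ => 1) fun Q _ => hp Q
      rwa [Finset.sum_const, smul_eq_mul, mul_one, Finset.card_univ, Fintype.card_subtype_compl,
        Fintype.card_subtype_eq, ← Set.toFinset_card, ← Set.ncard_eq_toFinset_card'] at this
    have hne : eval P.1.rep (∏ Q, p Q) ≠ 0 := by
      rw [map_prod]
      exact Finset.prod_ne_zero_iff.2 fun Q _ => hP Q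
    refine ⟨(eval P.1.rep (∏ Q, p Q))⁻¹ • ⟨_, hhom⟩, funext fun Q => ?_⟩
    rw [map_smul, Pi.smul_apply, evalForms_apply, Pi.basisFun_apply, smul_eq_mul]
    by_cases h : Q = P
    · subst h
      rw [Pi.single_eq_same, inv_mul_cancel₀ hne]
    · rw [Pi.single_eq_of_ne h]
      have : eval Q.1.rep (∏ Q, p Q) = 0 := by
        rw [map_prod]
        exact Finset.prod_eq_zero (Finset.mem_univ ⟨Q, h⟩) (hQ ⟨Q, h⟩)
      rw [this, mul_zero]
  rw [hilb_coneVanishingIdeal, hsurj, finrank_top, Module.finrank_fintype_fun_eq_card,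
    Set.ncard_eq_toFinset_card', Set.toFinset_card]

theorem hilb_add_le {m k : ℕ} {Q : Ideal (MvPolynomial (Fin m) ℂ)} (h : hilb m Q k ≤ k) (n : ℕ) :
    hilb m Q (k + n) ≤ hilb m Q k := by
  induction n with
  | zero => exact le_rfl
  | succ n ih => exact (hilb_succ_le (k := k + n) (by omega)).trans ih

theorem hilb_add_eq_zero {m k : ℕ} {Q : Ideal (MvPolynomial (Fin m) ℂ)} (h : hilb m Q k = 0)
    (n : ℕ) : hilb m Q (k + n) = 0 :=
  Nat.le_zero.1 ((hilb_add_le (by omega) n).trans_eq h)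

/-- A lower bound for the Hilbert function of an ideal that is nontrivial in degree `3 * d - 3`
and whose forms of degree at most `2 * d - 1` have no common zero. -/
theorem le_hilb_of_forall_exists_eval_ne_zero {m d : ℕ} (hd : 1 ≤ d)
    {Q : Ideal (MvPolynomial (Fin m) ℂ)}
    (hz : ∀ x : Fin m → ℂ, x ≠ 0 → ∃ j ≤ 2 * d - 1, ∃ p ∈ Q, p.IsHomogeneous j ∧ eval x p ≠ 0)
    (h0 : hilb m Q (3 * d - 3) ≠ 0) {j : ℕ} (hj : j ≤ 3 * d - 3) :
    min (j + 1) (min d (3 * d - 2 - j)) ≤ hilb m Q j := by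
  have htop : ∀ i < d, i + 1 ≤ hilb m Q (3 * d - 3 - i) := by
    intro i
    induction i with
    | zero => exact fun _ => Nat.pos_of_ne_zero h0
    | succ i ih =>
      intro hi
      have h1 := ih (by omega)
      obtain ⟨k, hk⟩ : ∃ k, k = 3 * d - 3 - (i + 1) := ⟨_, rfl⟩
      rw [show 3 * d - 3 - i = k + 1 by omega] at h1
      rw [← hk]
      by_contra! hlt
      have hne : hilb m Q k ≠ 0 := fun h => by
        have := hilb_succ_eq_zero h
        omega
      obtain ⟨x, hx, hx0⟩ := exists_common_zero (by omega) hne (by omega)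
      obtain ⟨j, hj, p, hp, hpj, hpx⟩ := hz x hx
      exact hpx (hx0 j (by omega) p hp hpj)
  rcases le_or_gt j (2 * d - 2) with hj2 | hj2
  · by_contra! hlt
    have h1 := htop (d - 1) (by omega)
    have h2 := hilb_add_le (m := m) (Q := Q) (k := j) (by omega) (2 * d - 2 - j)
    rw [show j + (2 * d - 2 - j) = 3 * d - 3 - (d - 1) by omega] at h2
    omega
  · have h1 := htop (3 * d - 3 - j) (by omega)
    rw [show 3 * d - 3 - (3 * d - 3 - j) = j by omega] at h1
    omega

theorem sum_range_min_eq {d : ℕ} (hd : 1 ≤ d) :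
    ∑ j ∈ Finset.range (3 * d - 2), min (j + 1) (min d (3 * d - 2 - j)) = d * (2 * d - 1) := by
  obtain ⟨e, rfl⟩ : ∃ e, d = e + 1 := ⟨d - 1, by omega⟩
  have hgauss : ∀ n, 2 * ∑ j ∈ Finset.range n, (j + 1) = n * (n + 1) := by
    intro n
    induction n with
    | zero => simp
    | succ n ih => rw [Finset.sum_range_succ, mul_add, ih]; ring
  rw [show 3 * (e + 1) - 2 = e + (e + (e + 1)) by omega, Finset.sum_range_add,
    Finset.sum_range_add]
  have h1 : ∑ j ∈ Finset.range e, min (j + 1) (min (e + 1) (e + (e + (e + 1)) - j)) =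
      ∑ j ∈ Finset.range e, (j + 1) :=
    Finset.sum_congr rfl fun j hj => by have := Finset.mem_range.1 hj; omega
  have h2 : ∑ j ∈ Finset.range e,
      min (e + j + 1) (min (e + 1) (e + (e + (e + 1)) - (e + j))) = e * (e + 1) := by
    rw [Finset.sum_congr rfl fun j hj => by
      have := Finset.mem_range.1 hj
      exact (show _ = e + 1 by omega)]
    simp
  have h3 : ∑ j ∈ Finset.range (e + 1),
      min (e + (e + j) + 1) (min (e + 1) (e + (e + (e + 1)) - (e + (e + j)))) =
      ∑ j ∈ Finset.range (e + 1), (j + 1) := by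
    rw [← Finset.sum_range_reflect (fun j => j + 1)]
    exact Finset.sum_congr rfl fun j hj => by have := Finset.mem_range.1 hj; omega
  rw [h1, h2, h3, show 2 * (e + 1) - 1 = 2 * e + 1 by omega]
  have := hgauss e
  have := hgauss (e + 1)
  nlinarith

theorem sum_hilb_le {m : ℕ} {I : Ideal (MvPolynomial (Fin m) ℂ)}
    (hI : I.IsHomogeneous (homogeneousSubmodule (Fin m) ℂ)) {v : Fin m → ℂ}
    (hv : ∀ k, ∀ p : MvPolynomial (Fin m) ℂ, p.IsHomogeneous k → linForm v * p ∈ I → p ∈ I)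
    (n : ℕ) :
    ∑ j ∈ Finset.range (n + 1), hilb m (I ⊔ Ideal.span {linForm v}) j ≤ hilb m I n := by
  induction n with
  | zero => simpa using hilb_anti le_sup_left 0
  | succ n ih =>
    rw [Finset.sum_range_succ, hilb_succ_eq_add hI (hv n)]
    exact Nat.add_le_add_right ih _

/-- If the points of `S` fail to impose independent conditions on forms of degree `k`, then a
hyperplane section of their ideal is nontrivial in degree `k + 1`. -/
theorem hilb_hyperplane_ne_zero {m k : ℕ} {S : Set (Projectivization ℂ (Fin m → ℂ))}
    (hS : S.Finite) {v : Fin m → ℂ} (hv : ∀ P ∈ S, eval P.rep (linForm v) ≠ 0)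
    (h : hilb m (coneVanishingIdeal m S) k < S.ncard) :
    hilb m (coneVanishingIdeal m S ⊔ Ideal.span {linForm v}) (k + 1) ≠ 0 := by
  intro h0
  have hstep : ∀ n, hilb m (coneVanishingIdeal m S) (n + 1) = hilb m (coneVanishingIdeal m S) n +
      hilb m (coneVanishingIdeal m S ⊔ Ideal.span {linForm v}) (n + 1) := fun n =>
    hilb_succ_eq_add (isHomogeneous_coneVanishingIdeal S) fun _ hp =>
      linForm_mul_mem_coneVanishingIdeal hv hp
  have hconst : ∀ n, hilb m (coneVanishingIdeal m S) (k + n) =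
      hilb m (coneVanishingIdeal m S) k := by
    intro n
    induction n with
    | zero => rfl
    | succ n ih =>
      rw [← add_assoc, hstep, ih, show k + n + 1 = k + 1 + n by omega, hilb_add_eq_zero h0]
      rfl
  have hmono : Monotone (hilb m (coneVanishingIdeal m S)) :=
    monotone_nat_of_le_succ fun n => (hstep n).symm ▸ Nat.le_add_right _ _
  have h1 := hmono (Nat.le_add_left (S.ncard - 1) k)
  rw [hconst, hilb_coneVanishingIdeal_ncard_sub_one hS] at h1
  omega

/-- Lifting generators of the hyperplane section of `I` to generators of `I`. -/
theorem mem_of_hyperplane_le {m k : ℕ} {I Q : Ideal (MvPolynomial (Fin m) ℂ)} (hQI : Q ≤ I)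
    (hQ : Q.IsHomogeneous (homogeneousSubmodule (Fin m) ℂ)) {v : Fin m → ℂ}
    (hv : ∀ k, ∀ p : MvPolynomial (Fin m) ℂ, p.IsHomogeneous k → linForm v * p ∈ I → p ∈ I)
    (h : hilb m (Q ⊔ Ideal.span {linForm v}) k ≤ hilb m (I ⊔ Ideal.span {linForm v}) k)
    (hprev : ∀ j, j + 1 = k → ∀ p ∈ I, p.IsHomogeneous j → p ∈ Q)
    {p : MvPolynomial (Fin m) ℂ} (hp : p ∈ I) (hpk : p.IsHomogeneous k) : p ∈ Q := by
  have hpQ := mem_of_hilb_le (sup_le_sup_right hQI _) h hpk (Ideal.mem_sup_left hp)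
  obtain ⟨q, hq, b, -, hb, hb0, rfl⟩ :=
    exists_homogeneous_of_mem_sup_span hQ (linForm_isHomogeneous v) hpk hpQ
  refine Q.add_mem hq (Q.mul_mem_left _ ?_)
  cases k with
  | zero => exact (hb0 zero_lt_one) ▸ Q.zero_mem
  | succ k =>
    exact hprev k rfl b (hv _ b hb ((Ideal.add_mem_iff_right I (hQI hq)).1 hp)) hb

theorem exists_hilb_hyperplane_le {m k : ℕ} {I Q : Ideal (MvPolynomial (Fin m) ℂ)}
    (hI : I.IsHomogeneous (homogeneousSubmodule (Fin m) ℂ)) {v : Fin m → ℂ}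
    (h : hilb m (Q ⊔ Ideal.span {linForm v}) k ≤ hilb m (I ⊔ Ideal.span {linForm v}) k + 1) :
    ∃ p ∈ I, p.IsHomogeneous k ∧ hilb m (Q ⊔ Ideal.span {p} ⊔ Ideal.span {linForm v}) k ≤
      hilb m (I ⊔ Ideal.span {linForm v}) k := by
  by_cases hall : ∀ p : MvPolynomial (Fin m) ℂ, p.IsHomogeneous k →
      p ∈ I ⊔ Ideal.span {linForm v} → p ∈ Q ⊔ Ideal.span {linForm v}
  · exact ⟨0, I.zero_mem, isHomogeneous_zero _ _ _,
      (hilb_anti (sup_le_sup_right le_sup_left _) k).trans (hilb_le_of_forall_mem hall)⟩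
  · push Not at hall
    obtain ⟨F, hF, hFI, hFQ⟩ := hall
    obtain ⟨p, hp, b, hpk, -, -, rfl⟩ :=
      exists_homogeneous_of_mem_sup_span hI (linForm_isHomogeneous v) hF hFI
    have hpQ : p ∉ Q ⊔ Ideal.span {linForm v} := fun hpQ => hFQ (Ideal.add_mem _ hpQ
      (Ideal.mem_sup_right (Ideal.mul_mem_right _ _ (Ideal.mem_span_singleton_self _))))
    have := hilb_sup_span_lt hpk hpQ
    rw [sup_right_comm] at this
    exact ⟨p, hp, hpk, by omega⟩

/-- An ideal of `ℂ[x₀, x₁, x₂, x₃]` whose hyperplane section has the Hilbert function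
of a complete intersection of type `(1, d, 2 * d - 1)` up to degree `2 * d - 1` is generated, in
the relevant degrees, by forms of degrees `1`, `d` and `2 * d - 1`. -/
theorem exists_generators {d : ℕ} (hd : 2 ≤ d) {I : Ideal (MvPolynomial (Fin 4) ℂ)}
    (hI : I.IsHomogeneous (homogeneousSubmodule (Fin 4) ℂ)) {v : Fin 4 → ℂ}
    (hv : ∀ k, ∀ p : MvPolynomial (Fin 4) ℂ, p.IsHomogeneous k → linForm v * p ∈ I → p ∈ I)
    (hh : ∀ j ≤ 3 * d - 3, hilb 4 (I ⊔ Ideal.span {linForm v}) j =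
      min (j + 1) (min d (3 * d - 2 - j))) :
    ∃ l h g : MvPolynomial (Fin 4) ℂ, l ∈ I ∧ h ∈ I ∧ g ∈ I ∧
      l.IsHomogeneous 1 ∧ h.IsHomogeneous d ∧ g.IsHomogeneous (2 * d - 1) ∧
      (∀ p ∈ I, p.IsHomogeneous 1 → p ∈ (⊥ ⊔ Ideal.span {l} : Ideal _)) ∧
      (∀ p ∈ I, p.IsHomogeneous d → p ∈ (⊥ ⊔ Ideal.span {l} ⊔ Ideal.span {h} : Ideal _)) ∧
      (∀ p ∈ I, p.IsHomogeneous (2 * d - 1) →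
        p ∈ (⊥ ⊔ Ideal.span {l} ⊔ Ideal.span {h} ⊔ Ideal.span {g} : Ideal _)) := by
  have hbot : (⊥ : Ideal (MvPolynomial (Fin 4) ℂ)).IsHomogeneous
      (homogeneousSubmodule (Fin 4) ℂ) := Ideal.IsHomogeneous.bot _
  have hL := linForm_isHomogeneous v
  have hv0 : linForm v ∉ (⊥ : Ideal (MvPolynomial (Fin 4) ℂ)) := by
    intro h
    have h1 : (1 : MvPolynomial (Fin 4) ℂ) ∈ I := hv 0 1 (isHomogeneous_one _ _)
      (by rw [(Submodule.mem_bot _).1 h, zero_mul]; exact I.zero_mem)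
    have h2 : hilb 4 (I ⊔ Ideal.span {linForm v}) 0 = 0 := hilb_eq_zero_iff.2 fun p _ =>
      ((Ideal.eq_top_iff_one _).2 (Ideal.mem_sup_left h1)) ▸ Submodule.mem_top
    have := hh 0 (by omega)
    omega
  have hstart : hilb 4 (⊥ ⊔ Ideal.span {linForm v}) 1 ≤
      hilb 4 (I ⊔ Ideal.span {linForm v}) 1 + 1 := by
    have h1 := hilb_sup_span_lt hL hv0
    have h2 := hilb_one_le (⊥ : Ideal (MvPolynomial (Fin 4) ℂ))
    have h3 := hh 1 (by omega)
    omega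
  obtain ⟨l, hl, hl1, hlv⟩ := exists_hilb_hyperplane_le (Q := ⊥) hI hstart
  have hQ1 := isHomogeneous_sup_span hbot hl1
  have hQ1I : ⊥ ⊔ Ideal.span {l} ≤ I :=
    sup_le bot_le ((Ideal.span_singleton_le_iff_mem I).2 hl)
  set Q1 : Ideal (MvPolynomial (Fin 4) ℂ) := ⊥ ⊔ Ideal.span {l}
  have hK : ∀ k, hilb 4 (Q1 ⊔ Ideal.span {linForm v}) k ≤ k + 1 :=
    hilb_le_succ (isHomogeneous_sup_span hQ1 hL) (by have := hh 1 (by omega); omega)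
  have hmem1 : ∀ k < d, ∀ p ∈ I, p.IsHomogeneous k → p ∈ Q1 := by
    intro k
    induction k with
    | zero =>
      intro _ p hp hpk
      refine mem_of_hyperplane_le hQ1I hQ1 hv ?_ (fun j hj => absurd hj (Nat.succ_ne_zero j)) hp hpk
      have := hh 0 (by omega)
      have := hK 0
      omega
    | succ k ih =>
      intro hk p hp hpk
      refine mem_of_hyperplane_le hQ1I hQ1 hv ?_ (fun j hj => ?_) hp hpk
      · have := hh (k + 1) (by omega)
        have := hK (k + 1)
        omega
      · obtain rfl : j = k := by omega
        exact ih (by omega)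
  obtain ⟨h, hhI, hhd, hhv⟩ := exists_hilb_hyperplane_le (k := d) (v := v) (Q := Q1) hI (by
    have := hh d (by omega)
    have := hK d
    omega)
  have hQ2 := isHomogeneous_sup_span hQ1 hhd
  have hQ2I : Q1 ⊔ Ideal.span {h} ≤ I := sup_le hQ1I ((Ideal.span_singleton_le_iff_mem I).2 hhI)
  set Q2 : Ideal (MvPolynomial (Fin 4) ℂ) := Q1 ⊔ Ideal.span {h}
  rw [hh d (by omega)] at hhv
  have hK2 : ∀ n, hilb 4 (Q2 ⊔ Ideal.span {linForm v}) (d + n) ≤ d := fun n =>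
    (hilb_add_le (by omega) n).trans (by omega)
  have hmem2 : ∀ n, d + n < 2 * d - 1 → ∀ p ∈ I, p.IsHomogeneous (d + n) → p ∈ Q2 := by
    intro n
    induction n with
    | zero =>
      intro _ p hp hpk
      refine mem_of_hyperplane_le hQ2I hQ2 hv ?_ (fun j hj q hq hqj =>
        Ideal.mem_sup_left (hmem1 j (by omega) q hq hqj)) hp hpk
      have := hh (d + 0) (by omega)
      have := hK2 0
      omega
    | succ n ih =>
      intro hk p hp hpk
      refine mem_of_hyperplane_le hQ2I hQ2 hv ?_ (fun j hj => ?_) hp hpk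
      · have := hh (d + (n + 1)) (by omega)
        have := hK2 (n + 1)
        omega
      · obtain rfl : j = d + n := by omega
        exact ih (by omega)
  obtain ⟨g, hgI, hgd, hgv⟩ := exists_hilb_hyperplane_le (k := 2 * d - 1) (v := v) (Q := Q2) hI (by
    have := hh (2 * d - 1) (by omega)
    have h1 := hK2 (d - 1)
    rw [show d + (d - 1) = 2 * d - 1 by omega] at h1
    omega)
  have hQ3 := isHomogeneous_sup_span hQ2 hgd
  have hQ3I : Q2 ⊔ Ideal.span {g} ≤ I := sup_le hQ2I ((Ideal.span_singleton_le_iff_mem I).2 hgI)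
  refine ⟨l, h, g, hl, hhI, hgI, hl1, hhd, hgd, hmem1 1 (by omega), ?_, fun p hp hpk => ?_⟩
  · exact hmem2 0 (by omega)
  · refine mem_of_hyperplane_le hQ3I hQ3 hv hgv (fun j hj q hq hqj => Ideal.mem_sup_left ?_) hp hpk
    have := hmem2 (j - d) (by omega) q hq
    rw [show d + (j - d) = j by omega] at this
    exact this hqj

/-- Suppose that the gradient of a form `f` is a combination of `r` polynomials vanishing at a
singular point `x` where the Hessian has rank at least `r`. Then the coefficients of the resulting
expression of `f` vanish at `x`. -/
theorem eval_sum_X_mul_eq_zero {m n r : ℕ} {f : MvPolynomial (Fin m) ℂ} (hf : f.IsHomogeneous n)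
    {F : Fin r → MvPolynomial (Fin m) ℂ} {c : Fin r → Fin m → MvPolynomial (Fin m) ℂ}
    (hc : ∀ i, pderiv i f = ∑ a, F a * c a i) {x : Fin m → ℂ} (hF : ∀ a, eval x (F a) = 0)
    (hx : ∀ i, eval x (pderiv i f) = 0) (hrank : r ≤ (hessian m f x).rank) (a : Fin r) :
    eval x (∑ i, X i * c a i) = 0 := by
  have hder : ∀ (b : Fin r → MvPolynomial (Fin m) ℂ) j, eval x (pderiv j (∑ a, F a * b a)) =
      ∑ a, eval x (pderiv j (F a)) * eval x (b a) := by
    intro b j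
    simp only [map_sum, pderiv_mul, map_add, map_mul, hF, zero_mul, add_zero]
  let D : Matrix (Fin m) (Fin r) ℂ := Matrix.of fun j a => eval x (pderiv j (F a))
  let E : Matrix (Fin r) (Fin m) ℂ := Matrix.of fun a i => eval x (c a i)
  have hDE : hessian m f x = D * E := by
    ext j i
    simp only [hessian, Matrix.of_apply, Matrix.mul_apply, D, E, hc i, hder]
  have hker : LinearMap.ker D.mulVecLin = ⊥ := by
    have h1 := LinearMap.finrank_range_add_finrank_ker D.mulVecLin
    have h2 : r ≤ finrank ℂ (LinearMap.range D.mulVecLin) :=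
      hrank.trans (hDE ▸ Matrix.rank_mul_le_left D E)
    rw [Module.finrank_fin_fun] at h1
    exact Submodule.finrank_eq_zero.1 (by omega)
  have heuler : n • f = ∑ a, F a * ∑ i, X i * c a i := by
    rw [← hf.sum_X_mul_pderiv]
    simp only [hc, Finset.mul_sum]
    rw [Finset.sum_comm]
    exact Finset.sum_congr rfl fun a _ => Finset.sum_congr rfl fun i _ => mul_left_comm _ _ _
  have hzero : (fun a => eval x (∑ i, X i * c a i)) ∈ LinearMap.ker D.mulVecLin := by
    rw [LinearMap.mem_ker]
    refine funext fun j => ?_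
    rw [Matrix.mulVecLin_apply, Pi.zero_apply]
    refine (hder (fun a => ∑ i, X i * c a i) j).symm.trans ?_
    rw [← heuler, map_nsmul, map_nsmul, hx, smul_zero]
  rw [hker, Submodule.mem_bot] at hzero
  exact congrFun hzero a

/-- A form lying in an ideal generated by two forms modulo squares. -/
theorem exists_eq_mul_add_sq {m d n : ℕ} (hn : n ≠ 0) {f l h p : MvPolynomial (Fin m) ℂ} {k : ℕ}
    (hp : p.IsHomogeneous k) (hh : h.IsHomogeneous d) {s : MvPolynomial (Fin m) ℂ}
    (hs : s.IsHomogeneous 0) (hf : n • f = l * p + s * h ^ 2) :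
    ∃ g h' : MvPolynomial (Fin m) ℂ, g.IsHomogeneous k ∧ h'.IsHomogeneous d ∧
      f = l * g + h' ^ 2 := by
  have hsC := totalDegree_eq_zero_iff_eq_C.1 ((totalDegree_zero_iff_isHomogeneous _).2 hs)
  obtain ⟨t, ht⟩ := IsAlgClosed.exists_pow_nat_eq (coeff 0 s / n) (n := 2) two_pos
  have hn' : (n : ℂ) ≠ 0 := Nat.cast_ne_zero.2 hn
  refine ⟨C (n : ℂ)⁻¹ * p, C t * h, hp.C_mul _, hh.C_mul _, ?_⟩
  have h1 : (C (n : ℂ)⁻¹ * C (n : ℂ) : MvPolynomial (Fin m) ℂ) = 1 := by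
    rw [← C_mul, inv_mul_cancel₀ hn', C_1]
  have h2 : (C t ^ 2 : MvPolynomial (Fin m) ℂ) = C (n : ℂ)⁻¹ * s := by
    rw [hsC, ← C_pow, ht, ← C_mul, div_eq_inv_mul]
  rw [nsmul_eq_mul, ← map_natCast (C : ℂ →+* MvPolynomial (Fin m) ℂ)] at hf
  linear_combination (-f) * h1 + C (n : ℂ)⁻¹ * hf - h ^ 2 * h2

/-- The Hilbert function of the hyperplane section of the nodes. -/
theorem hilb_hyperplane_singLocus {m d : ℕ} (hd : 2 ≤ d) {f : MvPolynomial (Fin m) ℂ}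
    (hf : f.IsHomogeneous (2 * d)) (hfin : (singLocus m f).Finite)
    (hdefect : hilb m (coneVanishingIdeal m (singLocus m f)) (3 * d - 4) < (singLocus m f).ncard)
    (hcard : (singLocus m f).ncard = d * (2 * d - 1)) {v : Fin m → ℂ}
    (hv : ∀ P ∈ singLocus m f, eval P.rep (linForm v) ≠ 0) {j : ℕ} (hj : j ≤ 3 * d - 3) :
    hilb m (coneVanishingIdeal m (singLocus m f) ⊔ Ideal.span {linForm v}) j =
      min (j + 1) (min d (3 * d - 2 - j)) := by
  have h0 := hilb_hyperplane_ne_zero hfin hv hdefect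
  rw [show 3 * d - 4 + 1 = 3 * d - 3 by omega] at h0
  have hz : ∀ x : Fin m → ℂ, x ≠ 0 → ∃ j ≤ 2 * d - 1,
      ∃ p ∈ coneVanishingIdeal m (singLocus m f) ⊔ Ideal.span {linForm v},
        p.IsHomogeneous j ∧ eval x p ≠ 0 := by
    intro x hx
    by_contra! hcon
    obtain ⟨t, ht⟩ := Projectivization.exists_smul_eq_mk_rep ℂ x hx
    have ht' : (Projectivization.mk ℂ x hx).rep = (t : ℂ) • x := ht.symm
    have hsing : Projectivization.mk ℂ x hx ∈ singLocus m f := by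
      intro i
      rw [ht', hf.pderiv.eval_smul, hcon _ le_rfl _ (Ideal.mem_sup_left ?_) hf.pderiv, mul_zero]
      rw [mem_coneVanishingIdeal_of_isHomogeneous hf.pderiv]
      exact fun P hP => hP i
    apply hv _ hsing
    rw [ht', (linForm_isHomogeneous v).eval_smul, hcon 1 (by omega) _
      (Ideal.mem_sup_right (Ideal.mem_span_singleton_self _)) (linForm_isHomogeneous v), mul_zero]
  have hle : ∀ j ∈ Finset.range (3 * d - 2), min (j + 1) (min d (3 * d - 2 - j)) ≤
      hilb m (coneVanishingIdeal m (singLocus m f) ⊔ Ideal.span {linForm v}) j := fun j hj =>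
    le_hilb_of_forall_exists_eval_ne_zero (by omega) hz h0
      (by have := Finset.mem_range.1 hj; omega)
  have hsum := (sum_hilb_le (isHomogeneous_coneVanishingIdeal _) (fun _ _ hp =>
    linForm_mul_mem_coneVanishingIdeal hv hp) (3 * d - 3)).trans (hilb_coneVanishingIdeal_le hfin _)
  rw [hcard, ← sum_range_min_eq (by omega), show 3 * d - 3 + 1 = 3 * d - 2 by omega] at hsum
  exact ((Finset.sum_eq_sum_iff_of_le hle).1 ((Finset.sum_le_sum hle).antisymm hsum) j
    (Finset.mem_range.2 (by omega))).symm

/-- if `V(f) ⊂ ℙ^3` is a nodal surface of degree `2d`, `d ≥ 2`,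
`f` squarefree, and the double cover `X : y² = f` has defect with exactly `d(2d-1)`
nodes, then `f = ℓ g + h²` for some forms `ℓ, g, h` of degrees `1, 2d-1, d`. -/
theorem double_cover_defect_min_nodes_structure (d : ℕ) (hd : 2 ≤ d)
    (f : MvPolynomial (Fin 4) ℂ) (hsf : Squarefree f) (hf : f.IsHomogeneous (2 * d))
    (hnodal : IsNodal 4 f)
    (hdefect : hilb 4 (coneVanishingIdeal 4 (singLocus 4 f)) (3 * d - 4) <
      (singLocus 4 f).ncard)
    (hcard : (singLocus 4 f).ncard = d * (2 * d - 1)) :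
    ∃ l g h : MvPolynomial (Fin 4) ℂ,
      l.IsHomogeneous 1 ∧ g.IsHomogeneous (2 * d - 1) ∧ h.IsHomogeneous d ∧
      f = l * g + h ^ 2 := by
  have hfin : (singLocus 4 f).Finite := Set.finite_of_ncard_pos (by omega)
  obtain ⟨v, hv⟩ := exists_linForm_eval_ne_zero hfin
  obtain ⟨l, h, g, hl, hh, hg, hl1, hhd, hgd, hI1, hId, hIg⟩ := exists_generators hd
    (isHomogeneous_coneVanishingIdeal (singLocus 4 f))
    (fun _ _ hp => linForm_mul_mem_coneVanishingIdeal hv hp)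
    (fun _ hj => hilb_hyperplane_singLocus hd hf hfin hdefect hcard hv hj)
  have hbot : (⊥ : Ideal (MvPolynomial (Fin 4) ℂ)).IsHomogeneous
      (homogeneousSubmodule (Fin 4) ℂ) := Ideal.IsHomogeneous.bot _
  have hQ1 := isHomogeneous_sup_span hbot hl1
  have hQ2 := isHomogeneous_sup_span hQ1 hhd
  have hgrad : ∀ i, ∃ p q r : MvPolynomial (Fin 4) ℂ, p.IsHomogeneous (2 * d - 1 - 1) ∧
      q.IsHomogeneous (2 * d - 1 - d) ∧ r.IsHomogeneous (2 * d - 1 - (2 * d - 1)) ∧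
      pderiv i f = l * p + h * q + g * r := by
    intro i
    have hmem : pderiv i f ∈ coneVanishingIdeal 4 (singLocus 4 f) := by
      rw [mem_coneVanishingIdeal_of_isHomogeneous hf.pderiv]
      exact fun P hP => hP i
    obtain ⟨w, hw, r, hwk, hr, -, hfw⟩ :=
      exists_homogeneous_of_mem_sup_span hQ2 hgd hf.pderiv (hIg _ hmem hf.pderiv)
    obtain ⟨w', hw', q, hwk', hq, -, rfl⟩ := exists_homogeneous_of_mem_sup_span hQ1 hhd hwk hw
    obtain ⟨w'', hw'', p, -, hp, -, rfl⟩ := exists_homogeneous_of_mem_sup_span hbot hl1 hwk' hw'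
    refine ⟨p, q, r, hp, hq, hr, ?_⟩
    rw [hfw, (Submodule.mem_bot _).1 hw'', zero_add]
  choose p q r hp hq hr hpqr using hgrad
  have hzero : ∀ a, ∀ P ∈ singLocus 4 f, eval P.rep (∑ i, X i * ![p, q, r] a i) = 0 := by
    intro a P hP
    refine eval_sum_X_mul_eq_zero (F := ![l, h, g]) hf (fun i => ?_) (fun b => ?_) hP ?_ a
    · simp [hpqr, Fin.sum_univ_three]
    · fin_cases b
      · exact (mem_coneVanishingIdeal_of_isHomogeneous hl1).1 hl P hP
      · exact (mem_coneVanishingIdeal_of_isHomogeneous hhd).1 hh P hP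
      · exact (mem_coneVanishingIdeal_of_isHomogeneous hgd).1 hg P hP
    · rw [hnodal P.rep P.rep_nonzero hP]
  have hsum : ∀ {k : ℕ} {u : Fin 4 → MvPolynomial (Fin 4) ℂ}, (∀ i, (u i).IsHomogeneous k) →
      (∑ i, X i * u i).IsHomogeneous (1 + k) := fun hu =>
    IsHomogeneous.sum _ _ _ fun i _ => (isHomogeneous_X _ i).mul (hu i)
  have hP1 := hsum hp
  have hQd := hsum hq
  have hR1 := hsum hr
  rw [show 1 + (2 * d - 1 - 1) = 2 * d - 1 by omega] at hP1
  rw [show 1 + (2 * d - 1 - d) = d by omega] at hQd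
  rw [show 1 + (2 * d - 1 - (2 * d - 1)) = 1 by omega] at hR1
  obtain ⟨w, hw, s, hwd, hs, -, hQs⟩ := exists_homogeneous_of_mem_sup_span hQ1 hhd hQd
    (hId _ ((mem_coneVanishingIdeal_of_isHomogeneous hQd).2 (hzero 1)) hQd)
  obtain ⟨w', hw', u, -, hu, -, rfl⟩ := exists_homogeneous_of_mem_sup_span hbot hl1 hwd hw
  obtain ⟨w'', hw'', c, -, hc, -, hRc⟩ := exists_homogeneous_of_mem_sup_span hbot hl1 hR1
    (hI1 _ ((mem_coneVanishingIdeal_of_isHomogeneous hR1).2 (hzero 2)) hR1)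
  rw [(Submodule.mem_bot _).1 hw', zero_add] at hQs
  rw [(Submodule.mem_bot _).1 hw'', zero_add] at hRc
  rw [Nat.sub_self] at hs
  have hhu := hhd.mul hu
  have hgc := hgd.mul hc
  rw [show d + (d - 1) = 2 * d - 1 by omega] at hhu
  rw [Nat.sub_self, add_zero] at hgc
  have heuler : (2 * d) • f = l * (∑ i, X i * p i + h * u + g * c) + s * h ^ 2 := by
    have h1 : (2 * d) • f = l * ∑ i, X i * p i + h * ∑ i, X i * q i + g * ∑ i, X i * r i := by
      rw [← hf.sum_X_mul_pderiv]
      simp only [hpqr, Finset.mul_sum, ← Finset.sum_add_distrib]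
      exact Finset.sum_congr rfl fun i _ => by ring
    rw [h1, hQs, hRc]
    ring
  obtain ⟨g', h', hg', hh', hfgh⟩ :=
    exists_eq_mul_add_sq (by omega) ((hP1.add hhu).add hgc) hhd hs heuler
  exact ⟨l, g', h', hl1, hg', hh', hfgh⟩
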